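/- Let X be a finite subset of R^k with diameter at most 1, and suppose X is contained in a closed ball of radius r = sqrt(k/(2(k+1))) centered at the origin (as guaranteed by Jung's theorem). Then there exists a Hamiltonian cycle H on X with sum over edges e of H of |e|^k at most 2e * (2k/(k+1))^{k/2} * (k+1), where e is Euler's number. -/

import Mathlib

/-- Cyclic successor on `Fin n`. -/
def nxt {n : ℕ} (i : Fin n) : Fin n := ⟨(i.val + 1) % n, Nat.mod_lt _ i.pos⟩

/-- `f` is a Hamiltonian cycle on the finite set `X`: a cyclic ordering of the points
of `X`, i.e. an injective enumeration of `X` by `Fin X.card`; its edges join `f i`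
and `f (nxt i)`. -/
def IsHamCycle {k : ℕ} (X : Finset (EuclideanSpace ℝ (Fin k)))
    (f : Fin X.card → EuclideanSpace ℝ (Fin k)) : Prop :=
  Function.Injective f ∧ ∀ x, x ∈ X ↔ ∃ i, f i = x

open Module in
/-- Pairwise strictly obtuse vectors in dimension `d` number at most `d + 1`. -/
theorem card_le_finrank_succ_of_inner_neg {V ι : Type*} [NormedAddCommGroup V]
    [InnerProductSpace ℝ V] [FiniteDimensional ℝ V] (s : Finset ι) (w : ι → V)
    (h : ∀ i ∈ s, ∀ j ∈ s, i ≠ j → inner ℝ (w i) (w j) < 0) :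
    s.card ≤ finrank ℝ V + 1 := by
  classical
  by_contra! hcard
  have hinj : Set.InjOn w s := by
    intro i hi j hj hij
    by_contra hne
    have := h i hi j hj hne
    rw [hij] at this
    exact absurd this (not_lt.2 real_inner_self_nonneg)
  have hobt : ∀ v ∈ s.image w, ∀ v' ∈ s.image w, v ≠ v' → inner ℝ v v' < 0 := by
    intro v hv v' hv' hne
    obtain ⟨i, hi, rfl⟩ := Finset.mem_image.1 hv
    obtain ⟨j, hj, rfl⟩ := Finset.mem_image.1 hv'
    exact h i hi j hj fun hij => hne (congrArg w hij)
  rw [← Finset.card_image_of_injOn hinj] at hcard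
  obtain ⟨c, hc, hc0, x, hx, hcx⟩ :=
    exists_nontrivial_relation_sum_zero_of_finrank_succ_lt_card hcard
  obtain ⟨p, hp, hcp⟩ := Finset.exists_pos_of_sum_zero_of_exists_nonzero c hc0 ⟨x, hx, hcx⟩
  obtain ⟨q, hq, hcq⟩ : ∃ q ∈ s.image w, c q < 0 := by
    by_contra! hnn
    exact hcx ((Finset.sum_eq_zero_iff_of_nonneg hnn).1 hc0 x hx)
  have hv : ∑ v ∈ s.image w, (c v)⁺ • v = ∑ v ∈ s.image w, (c v)⁻ • v := by
    rw [← sub_eq_zero, ← Finset.sum_sub_distrib, ← hc]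
    refine Finset.sum_congr rfl fun v _ => ?_
    rw [← sub_smul, posPart_sub_negPart]
  have hsq : 0 ≤ ∑ v ∈ s.image w, ∑ v' ∈ s.image w, (c v)⁺ * ((c v')⁻ * inner ℝ v v') := by
    have := real_inner_self_nonneg (x := ∑ v ∈ s.image w, (c v)⁺ • v)
    nth_rewrite 2 [hv] at this
    rw [sum_inner] at this
    simp only [inner_sum] at this
    refine this.trans_eq (Finset.sum_congr rfl fun v _ => Finset.sum_congr rfl fun v' _ => ?_)
    rw [real_inner_smul_left, real_inner_smul_right]
  have hterm : ∀ v ∈ s.image w, ∀ v' ∈ s.image w,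
      (c v)⁺ * ((c v')⁻ * inner ℝ v v') ≤ 0 := by
    intro v hv v' hv'
    by_cases hvv : v = v'
    · subst hvv
      rcases le_total 0 (c v) with h0 | h0
      · simp [negPart_eq_zero.2 h0]
      · simp [posPart_eq_zero.2 h0]
    · exact mul_nonpos_of_nonneg_of_nonpos (posPart_nonneg _)
        (mul_nonpos_of_nonneg_of_nonpos (negPart_nonneg _) (hobt v hv v' hv' hvv).le)
  have hpq : p ≠ q := by rintro rfl; linarith
  refine absurd hsq (not_le.2 ?_)
  refine Finset.sum_neg' (fun v hv => Finset.sum_nonpos (hterm v hv)) ⟨p, hp, ?_⟩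
  refine Finset.sum_neg' (hterm p hp) ⟨q, hq, ?_⟩
  exact mul_neg_of_pos_of_neg (posPart_pos hcp)
    (mul_neg_of_pos_of_neg (negPart_pos hcq) (hobt p hp q hq hpq))

theorem nxt_val_of_lt {n : ℕ} {i : Fin n} (h : i.val + 1 < n) : (nxt i).val = i.val + 1 :=
  Nat.mod_eq_of_lt h

theorem nxt_val_of_eq {n : ℕ} {i : Fin n} (h : i.val + 1 = n) : (nxt i).val = 0 := by
  simp [nxt, h]

/-- The reflection of the interval `{t | a ≤ t ≤ b}` of `Fin n`, fixing all other elements. -/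
def reflectIcc {n : ℕ} (a b t : Fin n) : Fin n :=
  if h : a ≤ t ∧ t ≤ b then ⟨a.val + b.val - t.val, by have := h.1; have := b.2; omega⟩ else t

theorem reflectIcc_val {n : ℕ} (a b t : Fin n) : (reflectIcc a b t).val =
    if a.val ≤ t.val ∧ t.val ≤ b.val then a.val + b.val - t.val else t.val := by
  simp only [reflectIcc, Fin.le_def]
  split_ifs <;> rfl

theorem reflectIcc_involutive {n : ℕ} (a b : Fin n) : Function.Involutive (reflectIcc a b) := by
  intro t
  ext
  simp only [reflectIcc_val]
  split_ifs <;> omega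

/-- The effect on the total cost of a cyclic ordering of reversing one of its segments. -/
theorem sum_reflectIcc {n : ℕ} {E : Type*} (f : Fin n → E) (g : E → E → ℝ)
    (hg : ∀ x y, g x y = g y x) (i j : Fin n) (hij : i < j) :
    ∑ t, g (f (reflectIcc (nxt i) j t)) (f (reflectIcc (nxt i) j (nxt t))) =
      ∑ t, g (f t) (f (nxt t)) + (g (f i) (f j) + g (f (nxt i)) (f (nxt j)))
        - (g (f i) (f (nxt i)) + g (f j) (f (nxt j))) := by
  classical
  have hij' : i.val < j.val := hij
  have hj := j.2
  have hi1 : (nxt i).val = i.val + 1 := nxt_val_of_lt (by omega)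
  have hnxt : ∀ t : Fin n, (t.val + 1 < n ∧ (nxt t).val = t.val + 1) ∨
      (t.val + 1 = n ∧ (nxt t).val = 0) := fun t => by
    rcases (show t.val + 1 ≤ n from t.2).lt_or_eq with h | h
    · exact .inl ⟨h, nxt_val_of_lt h⟩
    · exact .inr ⟨h, nxt_val_of_eq h⟩
  have hτi : reflectIcc (nxt i) j i = i := by
    ext; rw [reflectIcc_val, hi1]; split_ifs <;> omega
  have hτi1 : reflectIcc (nxt i) j (nxt i) = j := by
    ext; rw [reflectIcc_val, hi1]; split_ifs <;> omega
  have hτj : reflectIcc (nxt i) j j = nxt i := by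
    ext; rw [reflectIcc_val, hi1]; split_ifs <;> omega
  have hτj1 : reflectIcc (nxt i) j (nxt j) = nxt j := by
    ext; rw [reflectIcc_val, hi1]; rcases hnxt j with h | h <;> split_ifs <;> omega
  -- The edge starting at `t` in the interior of the segment becomes the edge starting at `ρ t`.
  let ρ : Fin n → Fin n := fun t => if t = i ∨ t = j then t else reflectIcc i j t
  have hρval : ∀ t, (ρ t).val =
      if i.val < t.val ∧ t.val < j.val then i.val + j.val - t.val else t.val := by
    intro t
    simp only [ρ]
    split_ifs with h1 h2 h2
    · rcases h1 with rfl | rfl <;> omega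
    · rfl
    · rw [reflectIcc_val]; split_ifs <;> omega
    · rw [Fin.ext_iff, Fin.ext_iff] at h1
      rw [reflectIcc_val]; split_ifs <;> omega
  have hρ : Function.Involutive ρ := by
    intro t
    ext
    simp only [hρval]
    split_ifs <;> omega
  have hρi : ρ i = i := by simp [ρ]
  have hρj : ρ j = j := by simp [ρ]
  set c : Fin n → ℝ := fun t => g (f t) (f (nxt t)) with hc
  set c' : Fin n → ℝ :=
    fun t => g (f (reflectIcc (nxt i) j t)) (f (reflectIcc (nxt i) j (nxt t))) with hc'
  have hmid : ∀ t, t ≠ i ∧ t ≠ j → c' (ρ t) - c t = 0 := by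
    rintro t ⟨hti, htj⟩
    have hti' : t.val ≠ i.val := fun h => hti (Fin.ext h)
    have htj' : t.val ≠ j.val := fun h => htj (Fin.ext h)
    rw [sub_eq_zero]
    by_cases hin : i.val < t.val ∧ t.val < j.val
    · have h1 : reflectIcc (nxt i) j (ρ t) = nxt t := by
        ext
        rw [reflectIcc_val, hi1, hρval]
        rcases hnxt t with h | h <;> split_ifs <;> omega
      have h2 : reflectIcc (nxt i) j (nxt (ρ t)) = t := by
        ext
        have := hρval t
        rw [reflectIcc_val, hi1]
        rw [if_pos hin] at this
        rcases hnxt (ρ t) with h | h <;> split_ifs <;> omega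
      simp only [hc, hc', h1, h2]
      exact hg _ _
    · have h0 : ρ t = t := by ext; rw [hρval, if_neg hin]
      have h1 : reflectIcc (nxt i) j t = t := by
        ext
        rw [reflectIcc_val, hi1]
        split_ifs <;> omega
      have h2 : reflectIcc (nxt i) j (nxt t) = nxt t := by
        ext
        rw [reflectIcc_val, hi1]
        rcases hnxt t with h | h <;> split_ifs <;> omega
      simp only [hc, hc', h0, h1, h2]
  have hsum : ∑ t, (c' (ρ t) - c t) = (c' (ρ i) - c i) + (c' (ρ j) - c j) :=
    Finset.sum_eq_add i j hij.ne (fun t _ ht => hmid t ht) (by simp) (by simp)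
  have hperm : ∑ t, c' (ρ t) = ∑ t, c' t := Equiv.sum_comp hρ.toPerm c'
  rw [Finset.sum_sub_distrib, hperm, hρi, hρj] at hsum
  have hci : c' i = g (f i) (f j) := by simp only [hc', hτi, hτi1]
  have hcj : c' j = g (f (nxt i)) (f (nxt j)) := by simp only [hc', hτj, hτj1]
  rw [hci, hcj] at hsum
  linarith

/-- Every finite set has a cyclic ordering that cannot be improved, for the sum of squared edge
lengths, by reversing a segment. -/
theorem exists_isHamCycle_two_opt {k : ℕ} (X : Finset (EuclideanSpace ℝ (Fin k))) :
    ∃ f, IsHamCycle X f ∧ ∀ i j, i ≠ j →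
      ‖f i - f (nxt i)‖ ^ 2 + ‖f j - f (nxt j)‖ ^ 2 ≤
        ‖f i - f j‖ ^ 2 + ‖f (nxt i) - f (nxt j)‖ ^ 2 := by
  classical
  let φ : Fin X.card → EuclideanSpace ℝ (Fin k) := fun i => (X.equivFin.symm i : _)
  obtain ⟨σ, hσ⟩ := Finite.exists_min fun σ : Equiv.Perm (Fin X.card) =>
    ∑ t, ‖φ (σ t) - φ (σ (nxt t))‖ ^ 2
  have key : ∀ i j, i < j →
      ‖φ (σ i) - φ (σ (nxt i))‖ ^ 2 + ‖φ (σ j) - φ (σ (nxt j))‖ ^ 2 ≤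
        ‖φ (σ i) - φ (σ j)‖ ^ 2 + ‖φ (σ (nxt i)) - φ (σ (nxt j))‖ ^ 2 := by
    intro i j hij
    have h1 := hσ ((reflectIcc_involutive (nxt i) j).toPerm.trans σ)
    have h2 := sum_reflectIcc (fun t => φ (σ t)) (fun x y => ‖x - y‖ ^ 2)
      (fun x y => by rw [norm_sub_rev]) i j hij
    simp only [Equiv.trans_apply, Function.Involutive.coe_toPerm] at h1 h2
    linarith
  refine ⟨fun t => φ (σ t), ⟨?_, fun x => ⟨fun hx => ?_, ?_⟩⟩, fun i j hij => ?_⟩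
  · exact Subtype.val_injective.comp (X.equivFin.symm.injective.comp σ.injective)
  · exact ⟨σ.symm (X.equivFin ⟨x, hx⟩), by simp [φ]⟩
  · rintro ⟨i, rfl⟩
    exact (X.equivFin.symm (σ i)).2
  · rcases lt_or_gt_of_ne hij with h | h
    · exact key i j h
    · have := key j i h
      rw [norm_sub_rev (φ (σ j)) (φ (σ i)),
        norm_sub_rev (φ (σ (nxt j))) (φ (σ (nxt i)))] at this
      linarith

/-- If reversing cannot improve two edges, then for each point `y` inside both balls having the
edges as diameters, the pairs (midpoint minus `y`, half edge) are at an obtuse angle. -/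
theorem inner_midpoint_add_inner_half_neg {E : Type*} [NormedAddCommGroup E]
    [InnerProductSpace ℝ E] {a b c d y : E}
    (h : ‖a - b‖ ^ 2 + ‖c - d‖ ^ 2 ≤ ‖a - c‖ ^ 2 + ‖b - d‖ ^ 2)
    (hab : ‖y - midpoint ℝ a b‖ < ‖a - b‖ / 2) (hcd : ‖y - midpoint ℝ c d‖ < ‖c - d‖ / 2) :
    inner ℝ (midpoint ℝ a b - y) (midpoint ℝ c d - y) +
      inner ℝ ((1 / 2 : ℝ) • (a - b)) ((1 / 2 : ℝ) • (c - d)) < 0 := by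
  have h1 := pow_lt_pow_left₀ hab (norm_nonneg _) two_ne_zero
  have h2 := pow_lt_pow_left₀ hcd (norm_nonneg _) two_ne_zero
  simp only [midpoint_eq_smul_add, invOf_eq_inv] at *
  simp only [div_pow, ← real_inner_self_eq_norm_sq, inner_sub_left, inner_sub_right,
    inner_add_left, inner_add_right, real_inner_smul_left, real_inner_smul_right] at *
  linarith [real_inner_comm a b, real_inner_comm c d, real_inner_comm a c, real_inner_comm b d,
    real_inner_comm a y, real_inner_comm b y, real_inner_comm c y, real_inner_comm d y]

open MeasureTheory in
theorem sum_measure_le_of_card_le {α ι : Type*} [MeasurableSpace α] [Fintype ι] (μ : Measure α)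
    {A : ι → Set α} {B : Set α} (hA : ∀ i, MeasurableSet (A i)) (hB : MeasurableSet B)
    (hAB : ∀ i, A i ⊆ B) (N : ℕ)
    (hN : ∀ y, ∀ s : Finset ι, (∀ i ∈ s, y ∈ A i) → s.card ≤ N) :
    ∑ i, μ (A i) ≤ N * μ B := by
  classical
  calc ∑ i, μ (A i) = ∑ i, ∫⁻ y, (A i).indicator 1 y ∂μ := by
        simp only [lintegral_indicator_one (hA _)]
    _ = ∫⁻ y, ∑ i, (A i).indicator 1 y ∂μ :=
        (lintegral_finsetSum _ fun i _ => measurable_one.indicator (hA i)).symm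
    _ ≤ ∫⁻ y, B.indicator (fun _ => (N : ENNReal)) y ∂μ := by
        refine lintegral_mono fun y => ?_
        by_cases hy : y ∈ B
        · have := hN y {i | y ∈ A i} (by simp)
          simp only [Set.indicator_apply, Pi.one_apply, Finset.sum_boole, hy, if_true]
          exact_mod_cast this
        · have : ∀ i, y ∉ A i := fun i hi => hy (hAB i hi)
          simp [this, hy]
    _ = N * μ B := lintegral_indicator_const hB _

open MeasureTheory in
/-- A half of a ball, cut off by a hyperplane through the centre, has half the volume. -/
theorem measure_ball_le_two_mul_half {E : Type*} [NormedAddCommGroup E] [InnerProductSpace ℝ E]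
    [MeasurableSpace E] [BorelSpace E] [FiniteDimensional ℝ E] (μ : Measure E)
    [μ.IsAddHaarMeasure] (m v : E) (s : ℝ) :
    μ (Metric.ball m s) ≤ 2 * μ (Metric.ball m s ∩ {y | inner ℝ (y - m) v ≤ 0}) := by
  set A := Metric.ball m s ∩ {y | inner ℝ (y - m) v ≤ 0} with hA
  have hmeas : MeasurableSet A := by
    refine Metric.isOpen_ball.measurableSet.inter (IsClosed.measurableSet ?_)
    exact isClosed_le (by fun_prop) continuous_const
  have hpre : μ ((fun y => (m + m) - y) ⁻¹' A) = μ A :=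
    (Measure.measurePreserving_sub_left μ (m + m)).measure_preimage hmeas.nullMeasurableSet
  have hsub : Metric.ball m s ⊆ A ∪ (fun y => (m + m) - y) ⁻¹' A := by
    intro y hy
    have he : m + m - y - m = -(y - m) := by abel
    rcases le_total (inner ℝ (y - m) v) 0 with h | h
    · exact .inl ⟨hy, h⟩
    · refine .inr ⟨?_, ?_⟩
      · rw [mem_ball_iff_norm] at hy ⊢
        rwa [he, norm_neg]
      · rw [Set.mem_ofPred_eq, he, inner_neg_left]
        linarith
  calc μ (Metric.ball m s) ≤ μ A + μ ((fun y => (m + m) - y) ⁻¹' A) :=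
        (measure_mono hsub).trans (measure_union_le _ _)
    _ = 2 * μ A := by rw [hpre, two_mul]

theorem half_ball_subset_closedBall {E : Type*} [NormedAddCommGroup E] [InnerProductSpace ℝ E]
    {a b : E} {r : ℝ} (ha : ‖a‖ ≤ r) (hb : ‖b‖ ≤ r) :
    Metric.ball (midpoint ℝ a b) (‖a - b‖ / 2) ∩
      {y | inner ℝ (y - midpoint ℝ a b) (midpoint ℝ a b) ≤ 0} ⊆ Metric.closedBall 0 r := by
  rintro y ⟨hy, hy'⟩
  rw [mem_ball_iff_norm] at hy
  rw [Set.mem_ofPred_eq] at hy'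
  have hr : 0 ≤ r := (norm_nonneg a).trans ha
  rw [mem_closedBall_zero_iff]
  refine le_of_sq_le_sq ?_ hr
  have h1 := pow_le_pow_left₀ (norm_nonneg _) ha 2
  have h2 := pow_le_pow_left₀ (norm_nonneg _) hb 2
  have h3 := pow_le_pow_left₀ (norm_nonneg _) hy.le 2
  have h4 : ‖y‖ ^ 2 = ‖y - midpoint ℝ a b‖ ^ 2 +
      2 * inner ℝ (y - midpoint ℝ a b) (midpoint ℝ a b) + ‖midpoint ℝ a b‖ ^ 2 := by
    rw [← norm_add_sq_real, sub_add_cancel]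
  have h5 : ‖midpoint ℝ a b‖ ^ 2 = (‖a‖ ^ 2 + ‖b‖ ^ 2) / 2 - (‖a - b‖ / 2) ^ 2 := by
    rw [midpoint_eq_smul_add, invOf_eq_inv, norm_smul, mul_pow, div_pow, norm_add_sq_real,
      norm_sub_sq_real]
    norm_num
    ring
  linarith

/-- A finite set in a ball of radius `r` has a Hamiltonian cycle whose edges satisfy
`∑ |e| ^ k ≤ 2 (2k + 1) (2r) ^ k`. -/
theorem exists_isHamCycle_sum_le {k : ℕ} (hk : k ≠ 0) (X : Finset (EuclideanSpace ℝ (Fin k)))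
    {r : ℝ} (hr : 0 ≤ r) (hX : ∀ x ∈ X, ‖x‖ ≤ r) :
    ∃ f, IsHamCycle X f ∧
      ∑ i, ‖f i - f (nxt i)‖ ^ k ≤ 2 * (2 * k + 1) * (2 * r) ^ k := by
  classical
  obtain ⟨f, hf, hopt⟩ := exists_isHamCycle_two_opt X
  refine ⟨f, hf, ?_⟩
  have hfX : ∀ i, ‖f i‖ ≤ r := fun i => hX _ ((hf.2 _).2 ⟨i, rfl⟩)
  have : Nonempty (Fin k) := ⟨⟨0, Nat.pos_of_ne_zero hk⟩⟩
  let μ : MeasureTheory.Measure (EuclideanSpace ℝ (Fin k)) := MeasureTheory.volume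
  let m i := midpoint ℝ (f i) (f (nxt i))
  let s i := ‖f i - f (nxt i)‖ / 2
  let A i := Metric.ball (m i) (s i) ∩ {y | inner ℝ (y - m i) (m i) ≤ 0}
  have hcount : ∀ y, ∀ t : Finset (Fin X.card), (∀ i ∈ t, y ∈ A i) → t.card ≤ 2 * k + 1 := by
    intro y t ht
    have := card_le_finrank_succ_of_inner_neg t
      (fun i => WithLp.toLp 2 (m i - y, (1 / 2 : ℝ) • (f i - f (nxt i)))) ?_
    · rw [(WithLp.linearEquiv 2 ℝ _).finrank_eq] at this
      simpa [two_mul] using this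
    · intro i hi j hj hij
      have hyi := (ht i hi).1
      have hyj := (ht j hj).1
      rw [mem_ball_iff_norm] at hyi hyj
      rw [WithLp.prod_inner_apply]
      exact inner_midpoint_add_inner_half_neg (hopt i j hij) hyi hyj
  have hmeas : ∀ i, MeasurableSet (A i) := fun i =>
    Metric.isOpen_ball.measurableSet.inter
      (isClosed_le (by fun_prop) continuous_const).measurableSet
  have hvol := sum_measure_le_of_card_le μ hmeas
    (Metric.isClosed_closedBall (x := 0) (ε := r)).measurableSet
    (fun i => half_ball_subset_closedBall (hfX i) (hfX _)) _ hcount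
  have hball : ∑ i, μ (Metric.ball (m i) (s i)) ≤
      2 * ((2 * k + 1 : ℕ) * μ (Metric.closedBall 0 r)) :=
    calc ∑ i, μ (Metric.ball (m i) (s i)) ≤ ∑ i, 2 * μ (A i) :=
          Finset.sum_le_sum fun i _ => measure_ball_le_two_mul_half μ _ _ _
      _ = 2 * ∑ i, μ (A i) := by rw [Finset.mul_sum]
      _ ≤ _ := by gcongr
  have hs : ∀ i, 0 ≤ s i := fun i => by positivity
  have hunit0 : μ (Metric.ball 0 1) ≠ 0 := (Metric.measure_ball_pos μ _ one_pos).ne'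
  have hunit : μ (Metric.ball 0 1) ≠ ⊤ := MeasureTheory.measure_ball_lt_top.ne
  simp only [MeasureTheory.Measure.addHaar_ball μ _ (hs _),
    MeasureTheory.Measure.addHaar_closedBall μ _ hr, finrank_euclideanSpace_fin,
    ← Finset.sum_mul, ← mul_assoc] at hball
  rw [ENNReal.mul_le_mul_iff_left hunit0 hunit,
    ← ENNReal.ofReal_sum_of_nonneg fun i _ => pow_nonneg (hs i) k] at hball
  have hreal : ∑ i, s i ^ k ≤ 2 * (2 * k + 1) * r ^ k := by
    refine (ENNReal.ofReal_le_ofReal_iff (by positivity)).1 (hball.trans_eq ?_)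
    rw [ENNReal.ofReal_mul (by positivity), ENNReal.ofReal_mul (by positivity)]
    congr 2
    · simp
    · rw [← ENNReal.ofReal_natCast]; push_cast; rfl
  calc ∑ i, ‖f i - f (nxt i)‖ ^ k = 2 ^ k * ∑ i, s i ^ k := by
        rw [Finset.mul_sum]
        refine Finset.sum_congr rfl fun i _ => ?_
        rw [← mul_pow, mul_div_cancel₀ _ two_ne_zero]
    _ ≤ 2 ^ k * (2 * (2 * k + 1) * r ^ k) := by gcongr
    _ = 2 * (2 * k + 1) * (2 * r) ^ k := by rw [mul_pow]; ring

theorem hamCycle_diameter_bound (k : ℕ) (X : Finset (EuclideanSpace ℝ (Fin k)))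
    (hdiam : ∀ x ∈ X, ∀ y ∈ X, ‖x - y‖ ≤ 1)
    (hball : ∀ x ∈ X, ‖x‖ ≤ Real.sqrt (k / (2 * (k + 1)))) :
    ∃ f : Fin X.card → EuclideanSpace ℝ (Fin k), IsHamCycle X f ∧
      ∑ i, ‖f i - f (nxt i)‖ ^ k ≤
        2 * Real.exp 1 * (2 * k / (k + 1)) ^ ((k : ℝ) / 2) * (k + 1) := by
  have hexp : (2 : ℝ) ≤ Real.exp 1 := by linarith [Real.add_one_le_exp (1 : ℝ)]
  rcases eq_or_ne k 0 with rfl | hk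
  · obtain ⟨f, hf, -⟩ := exists_isHamCycle_two_opt X
    refine ⟨f, hf, ?_⟩
    have hcard : (X.card : ℝ) ≤ 1 := by exact_mod_cast Finset.card_le_one_of_subsingleton X
    simp
    linarith
  · obtain ⟨f, hf, hle⟩ := exists_isHamCycle_sum_le hk X (Real.sqrt_nonneg _) hball
    refine ⟨f, hf, hle.trans ?_⟩
    have hpow : (2 * Real.sqrt (k / (2 * (k + 1)))) ^ k =
        (2 * k / (k + 1) : ℝ) ^ ((k : ℝ) / 2) := by
      have hsq : 2 * Real.sqrt (k / (2 * (k + 1))) = Real.sqrt (2 * k / (k + 1)) := by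
        rw [← Real.sqrt_sq (zero_le_two (α := ℝ)), ← Real.sqrt_mul (by positivity),
          Real.sqrt_sq zero_le_two]
        congr 1
        field_simp
      rw [hsq, Real.sqrt_eq_rpow, ← Real.rpow_natCast, ← Real.rpow_mul (by positivity)]
      congr 1
      ring
    rw [hpow]
    have hP : (0 : ℝ) ≤ (2 * k / (k + 1) : ℝ) ^ ((k : ℝ) / 2) := by positivity
    calc 2 * (2 * (k : ℝ) + 1) * (2 * k / (k + 1) : ℝ) ^ ((k : ℝ) / 2)
        ≤ 2 * (Real.exp 1 * (k + 1)) * (2 * k / (k + 1) : ℝ) ^ ((k : ℝ) / 2) := by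
          gcongr
          nlinarith [(Nat.cast_nonneg k : (0 : ℝ) ≤ k)]
      _ = _ := by ring
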